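/- Suppose F(z|τ) is an entire function of z, even in z, satisfying F(z|τ) = F(z+π|τ) = q³ e^{12iz} F(z+πτ|τ) for all z ∈ ℂ. Then for every x ∈ ℂ such that θ₁(2x|τ), θ₁(x|τ), θ₂(x|τ), θ₃(x|τ), θ₄(x|τ) are all nonzero, one has 4F(x|τ)/θ₁(2x|τ)² = F(0|τ)/θ₁(x|τ)² + F(π/2|τ)/θ₂(x|τ)² − q^{3/4}·F((π+πτ)/2|τ)/θ₃(x|τ)² − q^{3/4}·F(πτ/2|τ)/θ₄(x|τ)². -/

import Mathlib

noncomputable section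

open Complex

namespace Liu

/-- `π` as a complex number. -/
def piC : ℂ := Real.pi

/-- The nome `q = exp(2πiτ)`. -/
def qq (τ : ℂ) : ℂ := exp (2 * piC * I * τ)

/-- Jacobi theta function θ₁(z|τ). -/
def theta1 (z τ : ℂ) : ℂ :=
  -I * exp (piC * I * τ / 4) *
    ∑' n : ℤ, (-1 : ℂ) ^ n * exp (piC * I * τ * (n : ℂ) * ((n : ℂ) + 1)) *
      exp ((2 * (n : ℂ) + 1) * I * z)

/-- Jacobi theta function θ₂(z|τ). -/
def theta2 (z τ : ℂ) : ℂ :=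
  2 * ∑' n : ℕ, exp (piC * I * τ * (2 * (n : ℂ) + 1) ^ 2 / 4) * cos ((2 * (n : ℂ) + 1) * z)

/-- Jacobi theta function θ₃(z|τ). -/
def theta3 (z τ : ℂ) : ℂ :=
  1 + 2 * ∑' n : ℕ, exp (piC * I * τ * ((n : ℂ) + 1) ^ 2) * cos (2 * ((n : ℂ) + 1) * z)

/-- Jacobi theta function θ₄(z|τ). -/
def theta4 (z τ : ℂ) : ℂ :=
  1 + 2 * ∑' n : ℕ, (-1 : ℂ) ^ (n + 1) * exp (piC * I * τ * ((n : ℂ) + 1) ^ 2) *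
    cos (2 * ((n : ℂ) + 1) * z)

/-- θ₁'(τ) = (∂θ₁/∂z)(0|τ). -/
def theta1' (τ : ℂ) : ℂ := deriv (fun z => theta1 z τ) 0

/-- The Dedekind eta function. -/
def eta (τ : ℂ) : ℂ := exp (piC * I * τ / 12) * ∏' n : ℕ, (1 - qq τ ^ (n + 1))

/-- Eisenstein series L = E₂. -/
def EisL (τ : ℂ) : ℂ :=
  1 - 24 * ∑' n : ℕ, ((n : ℂ) + 1) * qq τ ^ (n + 1) / (1 - qq τ ^ (n + 1))

/-- Eisenstein series M = E₄. -/
def EisM (τ : ℂ) : ℂ :=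
  1 + 240 * ∑' n : ℕ, ((n : ℂ) + 1) ^ 3 * qq τ ^ (n + 1) / (1 - qq τ ^ (n + 1))

/-- The period lattice Λ = {mπ + nπτ : m, n ∈ ℤ}. -/
def Lambda (τ : ℂ) : Set ℂ := {z | ∃ m n : ℤ, z = (m : ℂ) * piC + (n : ℂ) * piC * τ}

/-- The Weierstrass ℘ function attached to the lattice with periods π and πτ. -/
def wp (τ z : ℂ) : ℂ :=
  1 / z ^ 2 + ∑' p : ℤ × ℤ,
    if p = (0, 0) then 0
    else 1 / (z - ((p.1 : ℂ) * piC + (p.2 : ℂ) * piC * τ)) ^ 2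
      - 1 / ((p.1 : ℂ) * piC + (p.2 : ℂ) * piC * τ) ^ 2

/-- Mathlib's two-variable theta function in the variable `z` with periods `π` and `πτ`. -/
def thetaT (τ z : ℂ) : ℂ := jacobiTheta₂ (z / piC) τ

theorem piC_ne_zero : piC ≠ 0 := by simp [piC]

theorem exp_piC_mul_I : exp (piC * I) = -1 := exp_pi_mul_I

theorem exp_piC_div_two_mul_I : exp (piC / 2 * I) = I := by
  simp [piC]

theorem exp_neg_piC_div_two_mul_I : exp (-(piC / 2 * I)) = -I := by
  rw [exp_neg, exp_piC_div_two_mul_I, inv_I]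

theorem thetaT_neg (τ z : ℂ) : thetaT τ (-z) = thetaT τ z := by
  simp [thetaT, neg_div]

theorem thetaT_add_piC (τ z : ℂ) : thetaT τ (z + piC) = thetaT τ z := by
  rw [thetaT, add_div, div_self piC_ne_zero, jacobiTheta₂_add_left, thetaT]

theorem thetaT_add_piC_mul (τ z : ℂ) :
    thetaT τ (z + piC * τ) = exp (-piC * I * τ - 2 * I * z) * thetaT τ z := by
  rw [thetaT, add_div, mul_div_cancel_left₀ _ piC_ne_zero, jacobiTheta₂_add_left', thetaT]
  congr 2
  have := piC_ne_zero
  change -piC * I * (τ + 2 * (z / piC)) = _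
  field_simp
  ring

theorem differentiable_thetaT {τ : ℂ} (hτ : 0 < τ.im) : Differentiable ℂ (thetaT τ) := fun z =>
  (differentiableAt_jacobiTheta₂_fst (z / piC) hτ).comp (f := fun z => z / piC) z (by fun_prop)

theorem hasSum_thetaT {τ : ℂ} (hτ : 0 < τ.im) (z : ℂ) :
    HasSum (fun n : ℤ => exp (2 * I * n * z + piC * I * n ^ 2 * τ)) (thetaT τ z) := by
  rw [thetaT]
  convert hasSum_jacobiTheta₂_term (z / piC) hτ using 2 with n
  rw [jacobiTheta₂_term]
  have := piC_ne_zero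
  change _ = exp (2 * piC * I * n * (z / piC) + piC * I * n ^ 2 * τ)
  congr 2
  field_simp

theorem exp_int_mul_piC_mul_I (n : ℤ) : exp (n * (piC * I)) = (-1) ^ n := by
  rw [exp_int_mul, exp_piC_mul_I]

theorem theta1_eq (z τ : ℂ) : theta1 z τ =
    -I * exp (I * z + piC * I * τ / 4) * thetaT τ (z + piC / 2 + piC * τ / 2) := by
  rw [theta1, add_comm (I * z), exp_add, ← mul_assoc, mul_assoc _ (exp (I * z))]
  congr 1
  rw [thetaT, jacobiTheta₂, ← tsum_mul_left]
  refine tsum_congr fun n => ?_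
  rw [jacobiTheta₂_term, ← exp_int_mul_piC_mul_I, ← exp_add, ← exp_add, ← exp_add]
  have := piC_ne_zero
  change _ = exp (_ + (2 * piC * I * n * _ + piC * I * _ * _))
  congr 1
  field_simp
  ring

theorem theta2_eq {τ : ℂ} (hτ : 0 < τ.im) (z : ℂ) : theta2 z τ =
    exp (I * z + piC * I * τ / 4) * thetaT τ (z + piC * τ / 2) := by
  rw [theta2, ← tsum_mul_left]
  have h := ((hasSum_thetaT hτ (z + piC * τ / 2)).mul_left
    (exp (I * z + piC * I * τ / 4))).nat_add_neg_add_one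
  rw [← h.tsum_eq]
  refine tsum_congr fun n => ?_
  rw [cos, ← exp_add, ← exp_add, mul_div_assoc', mul_add, ← exp_add, ← exp_add, add_div, mul_add,
    mul_div_cancel₀ _ two_ne_zero, mul_div_cancel₀ _ two_ne_zero]
  congr 2 <;> push_cast <;> ring

theorem theta3_eq {τ : ℂ} (hτ : 0 < τ.im) (z : ℂ) : theta3 z τ = thetaT τ z := by
  have h := (hasSum_nat_add_iff' 1).mpr (hasSum_thetaT hτ z).nat_add_neg
  have h2 : (∑' n : ℕ, 2 * (exp (piC * I * τ * ((n : ℂ) + 1) ^ 2) * cos (2 * ((n : ℂ) + 1) * z)))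
      = thetaT τ z - 1 := by
    refine Eq.trans (tsum_congr fun n => ?_) (h.tsum_eq.trans ?_)
    · rw [cos, mul_div_assoc', mul_add, ← exp_add, ← exp_add, mul_div_cancel₀ _ two_ne_zero]
      congr 2 <;> push_cast <;> ring
    · simp
  rw [theta3, ← tsum_mul_left, h2]
  ring

theorem theta4_eq {τ : ℂ} (hτ : 0 < τ.im) (z : ℂ) : theta4 z τ = thetaT τ (z + piC / 2) := by
  rw [← theta3_eq hτ, theta4, theta3]
  congr 2
  refine tsum_congr fun n => ?_
  have : 2 * ((n : ℂ) + 1) * (z + piC / 2) = 2 * ((n : ℂ) + 1) * z + ((n + 1 : ℕ) : ℂ) * piC := by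
    push_cast; ring
  rw [this, piC, show ∀ w : ℂ, cos (w + ((n + 1 : ℕ) : ℂ) * Real.pi) = (-1) ^ (n + 1) * cos w from
    fun w => cos_antiperiodic.add_nat_mul_eq (n + 1)]
  ring

theorem theta1_neg (z τ : ℂ) : theta1 (-z) τ = -theta1 z τ := by
  rw [theta1_eq, theta1_eq, ← thetaT_neg]
  have : -(-z + piC / 2 + piC * τ / 2) + piC + piC * τ = z + piC / 2 + piC * τ / 2 := by ring
  rw [← this, thetaT_add_piC_mul, thetaT_add_piC]
  have h : exp (I * z + piC * I * τ / 4) * exp (-piC * I * τ - 2 * I * (-(-z + piC / 2 + piC * τ / 2) + piC))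
      = -exp (I * -z + piC * I * τ / 4) := by
    rw [← exp_add, ← neg_one_mul (exp _), ← exp_piC_mul_I, ← exp_add, exp_eq_exp_iff_exists_int]
    refine ⟨-1, ?_⟩
    change _ = _ + _ * (2 * piC * I)
    push_cast
    ring
  linear_combination (-I * thetaT τ (-(-z + piC / 2 + piC * τ / 2))) * h

theorem theta2_neg (z τ : ℂ) : theta2 (-z) τ = theta2 z τ := by
  simp [theta2]

theorem theta3_neg (z τ : ℂ) : theta3 (-z) τ = theta3 z τ := by
  simp [theta3]

theorem theta4_neg (z τ : ℂ) : theta4 (-z) τ = theta4 z τ := by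
  simp [theta4]

theorem theta1_add_piC_div_two {τ : ℂ} (hτ : 0 < τ.im) (z : ℂ) :
    theta1 (z + piC / 2) τ = theta2 z τ := by
  rw [theta1_eq, theta2_eq hτ, ← thetaT_add_piC τ (z + piC * τ / 2)]
  have : I * (z + piC / 2) + piC * I * τ / 4 = piC / 2 * I + (I * z + piC * I * τ / 4) := by ring
  rw [this, exp_add, exp_piC_div_two_mul_I,
    show z + piC / 2 + piC / 2 + piC * τ / 2 = z + piC * τ / 2 + piC by ring]
  linear_combination (-exp (I * z + piC * I * τ / 4) * thetaT τ (z + piC * τ / 2 + piC)) * I_mul_I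

theorem theta1_add_piC (z τ : ℂ) : theta1 (z + piC) τ = -theta1 z τ := by
  rw [theta1_eq, theta1_eq, ← thetaT_add_piC τ (z + _ + _)]
  have : I * (z + piC) + piC * I * τ / 4 = piC * I + (I * z + piC * I * τ / 4) := by ring
  rw [this, exp_add, exp_piC_mul_I,
    show z + piC + piC / 2 + piC * τ / 2 = z + piC / 2 + piC * τ / 2 + piC by ring]
  ring

theorem theta2_add_piC_div_two {τ : ℂ} (hτ : 0 < τ.im) (z : ℂ) :
    theta2 (z + piC / 2) τ = -theta1 z τ := by
  rw [← theta1_add_piC_div_two hτ, ← theta1_add_piC]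
  congr 1
  ring

theorem theta3_add_piC_div_two {τ : ℂ} (hτ : 0 < τ.im) (z : ℂ) :
    theta3 (z + piC / 2) τ = theta4 z τ := by
  rw [theta4_eq hτ, theta3_eq hτ]

theorem theta4_add_piC_div_two {τ : ℂ} (hτ : 0 < τ.im) (z : ℂ) :
    theta4 (z + piC / 2) τ = theta3 z τ := by
  rw [theta4_eq hτ, theta3_eq hτ, ← thetaT_add_piC τ z]
  congr 1
  ring

theorem theta3_add_half {τ : ℂ} (hτ : 0 < τ.im) (z : ℂ) :
    theta3 (z + piC * τ / 2) τ = exp (-piC * I * τ / 4 - I * z) * theta2 z τ := by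
  rw [theta2_eq hτ, theta3_eq hτ, ← mul_assoc, ← exp_add]
  ring_nf
  simp

theorem theta2_add_half {τ : ℂ} (hτ : 0 < τ.im) (z : ℂ) :
    theta2 (z + piC * τ / 2) τ = exp (-piC * I * τ / 4 - I * z) * theta3 z τ := by
  rw [theta2_eq hτ, theta3_eq hτ, show z + piC * τ / 2 + piC * τ / 2 = z + piC * τ by ring,
    thetaT_add_piC_mul, ← mul_assoc, ← exp_add]
  congr 2
  ring

theorem theta4_add_half {τ : ℂ} (hτ : 0 < τ.im) (z : ℂ) :
    theta4 (z + piC * τ / 2) τ = I * exp (-piC * I * τ / 4 - I * z) * theta1 z τ := by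
  rw [← theta3_add_piC_div_two hτ, show z + piC * τ / 2 + piC / 2 = z + piC / 2 + piC * τ / 2 by ring,
    theta3_add_half hτ, theta2_add_piC_div_two hτ,
    show -piC * I * τ / 4 - I * (z + piC / 2) = -(piC / 2 * I) + (-piC * I * τ / 4 - I * z) by ring,
    exp_add, exp_neg_piC_div_two_mul_I]
  ring

theorem theta1_add_half {τ : ℂ} (hτ : 0 < τ.im) (z : ℂ) :
    theta1 (z + piC * τ / 2) τ = I * exp (-piC * I * τ / 4 - I * z) * theta4 z τ := by
  rw [← neg_neg (theta1 _ _), ← theta2_add_piC_div_two hτ,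
    show z + piC * τ / 2 + piC / 2 = z + piC / 2 + piC * τ / 2 by ring,
    theta2_add_half hτ, theta3_add_piC_div_two hτ,
    show -piC * I * τ / 4 - I * (z + piC / 2) = -(piC / 2 * I) + (-piC * I * τ / 4 - I * z) by ring,
    exp_add, exp_neg_piC_div_two_mul_I]
  ring

theorem exp_quarter_mul_exp_quarter (τ z : ℂ) :
    exp (-piC * I * τ / 4 - I * (z + piC * τ / 2)) * exp (-piC * I * τ / 4 - I * z) =
      exp (-piC * I * τ - 2 * I * z) := by
  rw [← exp_add]
  congr 1
  ring

theorem theta1_add_period {τ : ℂ} (hτ : 0 < τ.im) (z : ℂ) :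
    theta1 (z + piC * τ) τ = -exp (-piC * I * τ - 2 * I * z) * theta1 z τ := by
  rw [show z + piC * τ = z + piC * τ / 2 + piC * τ / 2 by ring, theta1_add_half hτ,
    theta4_add_half hτ, ← exp_quarter_mul_exp_quarter]
  ring_nf
  simp

theorem theta2_add_period {τ : ℂ} (hτ : 0 < τ.im) (z : ℂ) :
    theta2 (z + piC * τ) τ = exp (-piC * I * τ - 2 * I * z) * theta2 z τ := by
  rw [show z + piC * τ = z + piC * τ / 2 + piC * τ / 2 by ring, theta2_add_half hτ,
    theta3_add_half hτ, ← exp_quarter_mul_exp_quarter, ← mul_assoc]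

theorem theta3_add_period {τ : ℂ} (hτ : 0 < τ.im) (z : ℂ) :
    theta3 (z + piC * τ) τ = exp (-piC * I * τ - 2 * I * z) * theta3 z τ := by
  rw [show z + piC * τ = z + piC * τ / 2 + piC * τ / 2 by ring, theta3_add_half hτ,
    theta2_add_half hτ, ← exp_quarter_mul_exp_quarter, ← mul_assoc]

theorem theta4_add_period {τ : ℂ} (hτ : 0 < τ.im) (z : ℂ) :
    theta4 (z + piC * τ) τ = -exp (-piC * I * τ - 2 * I * z) * theta4 z τ := by
  rw [show z + piC * τ = z + piC * τ / 2 + piC * τ / 2 by ring, theta4_add_half hτ,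
    theta1_add_half hτ, ← exp_quarter_mul_exp_quarter]
  ring_nf
  simp

theorem theta2_add_piC {τ : ℂ} (hτ : 0 < τ.im) (z : ℂ) : theta2 (z + piC) τ = -theta2 z τ := by
  rw [← theta1_add_piC_div_two hτ, ← theta1_add_piC_div_two hτ, ← theta1_add_piC]
  congr 1
  ring

theorem theta3_add_piC {τ : ℂ} (hτ : 0 < τ.im) (z : ℂ) : theta3 (z + piC) τ = theta3 z τ := by
  rw [theta3_eq hτ, theta3_eq hτ, thetaT_add_piC]

theorem theta4_add_piC {τ : ℂ} (hτ : 0 < τ.im) (z : ℂ) : theta4 (z + piC) τ = theta4 z τ := by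
  rw [theta4_eq hτ, theta4_eq hτ, add_right_comm, thetaT_add_piC]

theorem differentiable_theta3 {τ : ℂ} (hτ : 0 < τ.im) : Differentiable ℂ (theta3 · τ) := by
  simpa only [theta3_eq hτ] using differentiable_thetaT hτ

theorem differentiable_theta4 {τ : ℂ} (hτ : 0 < τ.im) : Differentiable ℂ (theta4 · τ) := by
  have := differentiable_thetaT hτ
  simp only [theta4_eq hτ]
  fun_prop

theorem differentiable_theta2 {τ : ℂ} (hτ : 0 < τ.im) : Differentiable ℂ (theta2 · τ) := by
  have := differentiable_thetaT hτ
  simp only [theta2_eq hτ]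
  fun_prop

theorem differentiable_theta1 {τ : ℂ} (hτ : 0 < τ.im) : Differentiable ℂ (theta1 · τ) := by
  have := differentiable_thetaT hτ
  simp only [theta1_eq]
  fun_prop

theorem integral_add_of_periodic {g : ℂ → ℂ} (hg : Differentiable ℂ g)
    (hp : ∀ z, g (z + piC) = g z) (w : ℂ) :
    ∫ t in (0 : ℝ)..Real.pi, g (t + w) = ∫ t in (0 : ℝ)..Real.pi, g t := by
  have hper : Function.Periodic (fun t : ℝ => g (t + w.im * I)) Real.pi := fun t => by
    have := hp (t + w.im * I)
    rw [piC] at this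
    simp only [← this]
    push_cast
    congr 1
    ring
  have h1 : ∫ t in (0 : ℝ)..Real.pi, g (t + w) =
      ∫ t in (0 : ℝ)..Real.pi, g (t + w.im * I) := by
    have h := intervalIntegral.integral_comp_add_right (a := 0) (b := Real.pi)
      (fun t : ℝ => g (t + w.im * I)) w.re
    have h' := hper.intervalIntegral_add_eq w.re 0
    rw [zero_add, add_comm Real.pi, h', zero_add] at h
    rw [← h]
    refine intervalIntegral.integral_congr fun t _ => ?_
    simp only [ofReal_add, add_assoc, re_add_im]
  have h2 := integral_boundary_rect_eq_zero_of_differentiableOn g 0 (Real.pi + w.im * I)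
    hg.differentiableOn
  have h3 : ∀ y : ℝ, g (Real.pi + y * I) = g (y * I) := fun y => by
    rw [← hp (y * I), piC, add_comm]
  simp only [zero_re, zero_im, add_re, ofReal_re, mul_re, I_re, mul_zero, ofReal_im, I_im, mul_one,
    sub_self, add_zero, add_im, mul_im, zero_add, ofReal_zero, zero_mul, h3] at h2
  rw [h1]
  linear_combination -h2

/-- The `n`-th Fourier coefficient, up to the factor `π`, of a function of period `π`. -/
def fourierInt (f : ℂ → ℂ) (n : ℤ) : ℂ :=
  ∫ t in (0 : ℝ)..Real.pi, f t * exp (-(2 * I * n * t))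

theorem exp_periodic (n : ℤ) (z : ℂ) :
    exp (-(2 * I * n * (z + piC))) = exp (-(2 * I * n * z)) := by
  rw [exp_eq_exp_iff_exists_int]
  refine ⟨-n, ?_⟩
  change _ = _ + _ * (2 * piC * I)
  push_cast
  ring

theorem fourierInt_add {f g : ℂ → ℂ} (hf : Continuous f) (hg : Continuous g) (n : ℤ) :
    fourierInt (f + g) n = fourierInt f n + fourierInt g n := by
  simp only [fourierInt, Pi.add_apply, add_mul]
  exact intervalIntegral.integral_add (Continuous.intervalIntegrable (by fun_prop) _ _)
    (Continuous.intervalIntegrable (by fun_prop) _ _)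

theorem fourierInt_smul (c : ℂ) (f : ℂ → ℂ) (n : ℤ) :
    fourierInt (c • f) n = c * fourierInt f n := by
  simp only [fourierInt, Pi.smul_apply, smul_eq_mul, mul_assoc]
  exact intervalIntegral.integral_const_mul _ _

theorem fourierInt_neg {f : ℂ → ℂ} (hp : ∀ z, f (z + piC) = f z)
    (n : ℤ) : fourierInt f (-n) = fourierInt (fun z => f (-z)) n := by
  have h := intervalIntegral.integral_comp_sub_left (a := 0) (b := Real.pi)
    (fun t : ℝ => f t * exp (-(2 * I * (-n : ℤ) * t))) Real.pi
  rw [sub_self, sub_zero] at h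
  rw [fourierInt, ← h, fourierInt]
  refine intervalIntegral.integral_congr fun t _ => ?_
  have h1 := hp (-t)
  have h2 := exp_periodic (-n) (-t)
  change f ((Real.pi - t : ℝ) : ℂ) * exp (-(2 * I * (-n : ℤ) * ((Real.pi - t : ℝ) : ℂ))) = _
  rw [show ((Real.pi - t : ℝ) : ℂ) = -t + piC by rw [piC]; push_cast; ring, h1, h2]
  push_cast
  congr 2
  ring

/-- The two-term recursion for the Fourier coefficients of a quasi-periodic function. -/
theorem fourierInt_quasiperiodic {f : ℂ → ℂ} (hf : Differentiable ℂ f)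
    (hp : ∀ z, f (z + piC) = f z) {A τ : ℂ} {d : ℤ}
    (hq : ∀ z, f z = A * exp (2 * I * d * z) * f (z + piC * τ)) (n : ℤ) :
    fourierInt f n = A * exp (2 * I * (n - d) * (piC * τ)) * fourierInt f (n - d) := by
  have h := integral_add_of_periodic (g := fun z => f z * exp (-(2 * I * (n - d : ℤ) * z)))
    (by fun_prop) (fun z => by rw [hp, exp_periodic]) (piC * τ)
  rw [fourierInt, fourierInt, ← h, ← intervalIntegral.integral_const_mul]
  refine intervalIntegral.integral_congr fun t _ => ?_
  have h1 : exp (2 * I * (n - d) * (piC * τ)) * exp (-(2 * I * (n - d : ℤ) * (t + piC * τ))) =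
      exp (2 * I * d * t) * exp (-(2 * I * n * t)) := by
    rw [← exp_add, ← exp_add]
    push_cast
    congr 1
    ring
  change f t * exp (-(2 * I * n * t)) = _
  rw [hq t]
  linear_combination (-A * f (t + piC * τ)) * h1

/-- An entire function of period `π` with vanishing Fourier coefficients is zero. -/
theorem eq_zero_of_fourierInt_eq_zero {f : ℂ → ℂ} (hf : Differentiable ℂ f)
    (hp : ∀ z, f (z + piC) = f z) (h0 : ∀ n, fourierInt f n = 0) (z : ℂ) : f z = 0 := by
  have : Fact (0 < Real.pi) := ⟨Real.pi_pos⟩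
  have hper : Function.Periodic (fun t : ℝ => f t) Real.pi := fun t => by
    simp only [← hp t, piC, ofReal_add]
  let g : C(AddCircle Real.pi, ℂ) := ⟨hper.lift, by
    refine continuous_coinduced_dom.mpr ?_
    exact hf.continuous.comp continuous_ofReal⟩
  have hg : ∀ t : ℝ, g t = f t := fun t => rfl
  have hc : ∀ n, fourierCoeff g n = 0 := fun n => by
    rw [fourierCoeff_eq_intervalIntegral _ n 0, zero_add]
    have := h0 n
    rw [fourierInt] at this
    convert smul_zero _
    rw [← this]
    refine intervalIntegral.integral_congr fun t _ => ?_
    rw [fourier_coe_apply, hg, smul_eq_mul, mul_comm]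
    congr 2
    have : (Real.pi : ℂ) ≠ 0 := piC_ne_zero
    field_simp
    push_cast
    ring
  have hs := hasSum_fourier_series_of_summable (f := g) (by
    rw [show fourierCoeff g = fun _ => 0 from funext hc]
    exact summable_zero)
  have hg0 : g = 0 := by
    simp only [hc, zero_smul] at hs
    exact hs.unique hasSum_zero
  have hreal : ∀ t : ℝ, f t = 0 := fun t => by rw [← hg, hg0]; rfl
  have hfreq : ∃ᶠ w in nhdsWithin (0 : ℂ) {0}ᶜ, f w = (fun _ => (0 : ℂ)) w := by
    have ht : Filter.Tendsto (fun t : ℝ => (t : ℂ)) (nhdsWithin 0 {0}ᶜ)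
        (nhdsWithin (0 : ℂ) {0}ᶜ) := by
      refine tendsto_nhdsWithin_iff.mpr ⟨?_, ?_⟩
      · exact (continuous_ofReal.tendsto' 0 0 ofReal_zero).mono_left nhdsWithin_le_nhds
      · filter_upwards [self_mem_nhdsWithin] with t ht
        simpa using ht
    exact ht.frequently (Filter.Frequently.of_forall hreal)
  exact congrFun (AnalyticOnNhd.eq_of_frequently_eq
    (fun z _ => hf.analyticAt z) (fun z _ => analyticAt_const) hfreq) z

/-- A quasi-periodic function of degree `d` is determined by `d` consecutive Fourier
coefficients. -/
theorem eq_zero_of_quasiperiodic {f : ℂ → ℂ} (hf : Differentiable ℂ f)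
    (hp : ∀ z, f (z + piC) = f z) {A τ : ℂ} (hA : A ≠ 0) {d : ℤ} (hd : 0 < d)
    (hq : ∀ z, f z = A * exp (2 * I * d * z) * f (z + piC * τ))
    (h0 : ∀ n, 0 ≤ n → n < d → fourierInt f n = 0) (z : ℂ) : f z = 0 := by
  refine eq_zero_of_fourierInt_eq_zero hf hp (fun n => ?_) z
  have hP : Function.Periodic (fun n => fourierInt f n = 0) d := fun n => by
    simp [fourierInt_quasiperiodic hf hp hq (n + d), hA, exp_ne_zero]
  have h := hP.sub_int_mul_eq (x := n) (n / d)
  have h' : fourierInt f (n - n / d * d) = 0 := by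
    rw [mul_comm, ← Int.emod_def]
    exact h0 _ (Int.emod_nonneg _ hd.ne') (Int.emod_lt_of_pos _ hd)
  simpa [h'] using h

/-- Entire functions of period `π` with the quasi-periodicity `f(z) = A e^{2idz} f(z + πτ)`. -/
def quasiPeriodicSpace (A τ : ℂ) (d : ℤ) : Submodule ℂ (ℂ → ℂ) where
  carrier := {f | Differentiable ℂ f ∧ (∀ z, f (z + piC) = f z) ∧
    ∀ z, f z = A * exp (2 * I * d * z) * f (z + piC * τ)}
  add_mem' := by
    rintro f g ⟨hf, hf', hf''⟩ ⟨hg, hg', hg''⟩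
    refine ⟨hf.add hg, fun z => ?_, fun z => ?_⟩
    · simp only [Pi.add_apply, hf', hg']
    · simp only [Pi.add_apply, mul_add, ← hf'', ← hg'']
  zero_mem' := ⟨differentiable_const 0, by simp, by simp⟩
  smul_mem' := by
    rintro c f ⟨hf, hf', hf''⟩
    refine ⟨hf.const_smul c, fun z => ?_, fun z => ?_⟩
    · simp only [Pi.smul_apply, hf']
    · rw [Pi.smul_apply, Pi.smul_apply, hf'', smul_eq_mul, smul_eq_mul]
      ring

/-- Functions `f` with `f(-z) = ε f(z)`. -/
def paritySpace (ε : ℂ) : Submodule ℂ (ℂ → ℂ) where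
  carrier := {f | ∀ z, f (-z) = ε * f z}
  add_mem' := by
    intro f g hf hg z
    rw [Pi.add_apply, Pi.add_apply, hf, hg, mul_add]
  zero_mem' := by simp
  smul_mem' := by
    intro c f hf z
    rw [Pi.smul_apply, Pi.smul_apply, hf, smul_eq_mul, smul_eq_mul, mul_left_comm]

theorem fourierInt_neg_of_parity {A τ ε : ℂ} {d : ℤ} {f : ℂ → ℂ}
    (hf : f ∈ quasiPeriodicSpace A τ d ⊓ paritySpace ε) (n : ℤ) :
    fourierInt f (-n) = ε * fourierInt f n := by
  rw [fourierInt_neg hf.1.2.1, ← fourierInt_smul]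
  congr 1
  exact funext hf.2

theorem fourierInt_eq_of_parity {A τ ε : ℂ} {d : ℤ} {f : ℂ → ℂ}
    (hf : f ∈ quasiPeriodicSpace A τ d ⊓ paritySpace ε) (n : ℤ) :
    fourierInt f n = A * exp (2 * I * (n - d) * (piC * τ)) * (ε * fourierInt f (d - n)) := by
  rw [fourierInt_quasiperiodic hf.1.1 hf.1.2.1 hf.1.2.2, ← fourierInt_neg_of_parity hf, neg_sub]

/-- Two elements of a space on which a single Fourier coefficient is injective are
proportional. -/
theorem fourierInt_mul_comm {A τ ε : ℂ} {d : ℤ} (n : ℤ)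
    (hinj : ∀ h ∈ quasiPeriodicSpace A τ d ⊓ paritySpace ε, fourierInt h n = 0 → ∀ z, h z = 0)
    {f g : ℂ → ℂ} (hf : f ∈ quasiPeriodicSpace A τ d ⊓ paritySpace ε)
    (hg : g ∈ quasiPeriodicSpace A τ d ⊓ paritySpace ε) (z : ℂ) :
    fourierInt g n * f z = fourierInt f n * g z := by
  have h := hinj _ (Submodule.add_mem _ (Submodule.smul_mem _ (fourierInt g n) hf)
    (Submodule.smul_mem _ (-fourierInt f n) hg)) (by
      have hf' := hf.1.1.continuous
      have hg' := hg.1.1.continuous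
      rw [fourierInt_add (hf'.const_smul _) (hg'.const_smul _), fourierInt_smul, fourierInt_smul]
      ring) z
  rw [Pi.add_apply, Pi.smul_apply, Pi.smul_apply, smul_eq_mul, smul_eq_mul] at h
  linear_combination h

theorem eq_zero_of_odd_degree_four {τ : ℂ} {h : ℂ → ℂ}
    (hh : h ∈ quasiPeriodicSpace (exp (4 * piC * I * τ)) τ 4 ⊓ paritySpace (-1))
    (h1 : fourierInt h 1 = 0) (z : ℂ) : h z = 0 := by
  refine eq_zero_of_quasiperiodic hh.1.1 hh.1.2.1 (exp_ne_zero _) (by norm_num) hh.1.2.2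
    (fun n hn hn' => ?_) z
  interval_cases n
  · have := fourierInt_neg_of_parity hh 0
    rw [neg_zero] at this
    linear_combination this / 2
  · exact h1
  · have := fourierInt_eq_of_parity hh 2
    rw [← mul_assoc, ← exp_add] at this
    norm_num at this
    rw [show 4 * piC * I * τ + -(2 * I * 2 * (piC * τ)) = 0 by ring, exp_zero] at this
    linear_combination this / 2
  · rw [fourierInt_eq_of_parity hh 3, show (4 : ℤ) - 3 = 1 by norm_num, h1]
    simp

theorem eq_zero_of_even_degree_two {τ : ℂ} {h : ℂ → ℂ}
    (hh : h ∈ quasiPeriodicSpace (-exp (2 * piC * I * τ)) τ 2 ⊓ paritySpace 1)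
    (h0 : fourierInt h 0 = 0) (z : ℂ) : h z = 0 := by
  refine eq_zero_of_quasiperiodic hh.1.1 hh.1.2.1 (neg_ne_zero.mpr (exp_ne_zero _)) (by norm_num)
    hh.1.2.2 (fun n hn hn' => ?_) z
  interval_cases n
  · exact h0
  · have := fourierInt_eq_of_parity hh 1
    rw [neg_mul, ← exp_add] at this
    norm_num at this
    rw [show 2 * piC * I * τ + -(2 * I * (piC * τ)) = 0 by ring, exp_zero] at this
    linear_combination this / 2

theorem eq_zero_of_even_degree_six {A τ : ℂ} (hA : A ≠ 0) {h : ℂ → ℂ}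
    (hh : h ∈ quasiPeriodicSpace A τ 6 ⊓ paritySpace 1)
    (h0 : ∀ i : Fin 4, fourierInt h (i : ℕ) = 0) (z : ℂ) : h z = 0 := by
  refine eq_zero_of_quasiperiodic hh.1.1 hh.1.2.1 hA (by norm_num)
    hh.1.2.2 (fun n hn hn' => ?_) z
  interval_cases n
  · exact h0 0
  · exact h0 1
  · exact h0 2
  · exact h0 3
  · rw [fourierInt_eq_of_parity hh 4, show (6 : ℤ) - 4 = 2 by norm_num,
      show fourierInt h 2 = 0 from h0 2]
    simp
  · rw [fourierInt_eq_of_parity hh 5, show (6 : ℤ) - 5 = 1 by norm_num,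
      show fourierInt h 1 = 0 from h0 1]
    simp

/-- Even quasi-periodic functions of degree six are interpolated at four points by any four
functions with a nonzero diagonal evaluation matrix. -/
theorem eq_sum_of_even_degree_six {A τ : ℂ} (hA : A ≠ 0) {F : ℂ → ℂ}
    (hF : F ∈ quasiPeriodicSpace A τ 6 ⊓ paritySpace 1) {G : Fin 4 → ℂ → ℂ}
    (hG : ∀ i, G i ∈ quasiPeriodicSpace A τ 6 ⊓ paritySpace 1) {p : Fin 4 → ℂ}
    (hne : ∀ i, G i (p i) ≠ 0) (hoff : ∀ i j, i ≠ j → G i (p j) = 0) (z : ℂ) :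
    F z = ∑ i, F (p i) / G i (p i) * G i z := by
  let V := quasiPeriodicSpace A τ 6 ⊓ paritySpace 1
  let Φ : V →ₗ[ℂ] (Fin 4 → ℂ) :=
    { toFun := fun f i => fourierInt f.1 (i : ℕ)
      map_add' := fun f g => funext fun i =>
        fourierInt_add f.2.1.1.continuous g.2.1.1.continuous _
      map_smul' := fun c f => funext fun i => fourierInt_smul _ _ _ }
  have hΦ : Function.Injective Φ := by
    rw [injective_iff_map_eq_zero]
    intro f hf
    ext z
    exact eq_zero_of_even_degree_six hA f.2 (fun i => congrFun hf i) z
  let E : V →ₗ[ℂ] (Fin 4 → ℂ) :=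
    { toFun := fun f i => f.1 (p i)
      map_add' := fun f g => rfl
      map_smul' := fun c f => rfl }
  let S : (Fin 4 → ℂ) → V := fun y => ∑ i, (y i / G i (p i)) • ⟨G i, hG i⟩
  have hS : ∀ y z, (S y).1 z = ∑ i, y i / G i (p i) * G i z := fun y z => by
    simp [S]
  have hES : ∀ y, E (S y) = y := fun y => by
    ext j
    change (S y).1 (p j) = y j
    rw [hS, Finset.sum_eq_single j (fun i _ hij => by rw [hoff i j hij, mul_zero]) (by simp),
      div_mul_cancel₀ _ (hne j)]
  have hsurj : Function.Surjective E := fun y => ⟨S y, hES y⟩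
  have : FiniteDimensional ℂ V := FiniteDimensional.of_injective Φ hΦ
  have hdim : Module.finrank ℂ V = Module.finrank ℂ (Fin 4 → ℂ) :=
    le_antisymm (LinearMap.finrank_le_finrank_of_injective hΦ)
      (LinearMap.finrank_le_finrank_of_surjective hsurj)
  have hinj := (LinearMap.injective_iff_surjective_of_finrank_eq_finrank hdim).mpr hsurj
  have h := hinj (hES (E ⟨F, hF⟩))
  rw [← hS (fun i => F (p i)) z]
  exact (congrFun (congrArg Subtype.val h) z).symm

theorem theta1_zero (τ : ℂ) : theta1 0 τ = 0 := by
  have h := theta1_neg 0 τ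
  rw [neg_zero] at h
  linear_combination h / 2

theorem theta_prod_mem {τ : ℂ} (hτ : 0 < τ.im) :
    (fun z => theta1 z τ * theta2 z τ * theta3 z τ * theta4 z τ) ∈
      quasiPeriodicSpace (exp (4 * piC * I * τ)) τ 4 ⊓ paritySpace (-1) := by
  have d1 := differentiable_theta1 hτ
  have d2 := differentiable_theta2 hτ
  have d3 := differentiable_theta3 hτ
  have d4 := differentiable_theta4 hτ
  refine ⟨⟨by fun_prop, fun z => ?_, fun z => ?_⟩, fun z => ?_⟩
  · simp only [theta1_add_piC, theta2_add_piC hτ, theta3_add_piC hτ, theta4_add_piC hτ]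
    ring
  · have h : exp (4 * piC * I * τ) * exp (2 * I * (4 : ℤ) * z) *
        exp (-piC * I * τ - 2 * I * z) ^ 4 = 1 := by
      rw [← exp_nat_mul, ← exp_add, ← exp_add, exp_eq_one_iff]
      exact ⟨0, by push_cast; ring⟩
    simp only [theta1_add_period hτ, theta2_add_period hτ, theta3_add_period hτ,
      theta4_add_period hτ]
    linear_combination -(theta1 z τ * theta2 z τ * theta3 z τ * theta4 z τ) * h
  · simp only [theta1_neg, theta2_neg, theta3_neg, theta4_neg]
    ring

theorem theta1_two_mul_mem {τ : ℂ} (hτ : 0 < τ.im) :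
    (fun z => theta1 (2 * z) τ) ∈
      quasiPeriodicSpace (exp (4 * piC * I * τ)) τ 4 ⊓ paritySpace (-1) := by
  have d1 := differentiable_theta1 hτ
  refine ⟨⟨by fun_prop, fun z => ?_, fun z => ?_⟩, fun z => ?_⟩
  · simp only [mul_add, two_mul piC, ← add_assoc, theta1_add_piC, neg_neg]
  · have h : exp (4 * piC * I * τ) * exp (2 * I * (4 : ℤ) * z) *
        (exp (-piC * I * τ - 2 * I * (2 * z + piC * τ)) * exp (-piC * I * τ - 2 * I * (2 * z)))
          = 1 := by
      rw [← exp_add, ← exp_add, ← exp_add, exp_eq_one_iff]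
      exact ⟨0, by push_cast; ring⟩
    simp only [show 2 * (z + piC * τ) = 2 * z + piC * τ + piC * τ by ring, theta1_add_period hτ]
    linear_combination -(theta1 (2 * z) τ) * h
  · simp only [mul_neg, theta1_neg]
    ring

theorem theta34_mem {τ : ℂ} (hτ : 0 < τ.im) :
    (fun z => theta3 z τ * theta4 z τ) ∈
      quasiPeriodicSpace (-exp (2 * piC * I * τ)) τ 2 ⊓ paritySpace 1 := by
  have d3 := differentiable_theta3 hτ
  have d4 := differentiable_theta4 hτ
  refine ⟨⟨by fun_prop, fun z => ?_, fun z => ?_⟩, fun z => ?_⟩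
  · simp only [theta3_add_piC hτ, theta4_add_piC hτ]
  · have h : exp (2 * piC * I * τ) * exp (2 * I * (2 : ℤ) * z) *
        exp (-piC * I * τ - 2 * I * z) ^ 2 = 1 := by
      rw [← exp_nat_mul, ← exp_add, ← exp_add, exp_eq_one_iff]
      exact ⟨0, by push_cast; ring⟩
    simp only [theta3_add_period hτ, theta4_add_period hτ]
    linear_combination -(theta3 z τ * theta4 z τ) * h
  · simp only [theta3_neg, theta4_neg, one_mul]

theorem theta_wronskian_mem {τ : ℂ} (hτ : 0 < τ.im) :
    (fun z => deriv (theta1 · τ) z * theta2 z τ - theta1 z τ * deriv (theta2 · τ) z) ∈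
      quasiPeriodicSpace (-exp (2 * piC * I * τ)) τ 2 ⊓ paritySpace 1 := by
  have d1 := differentiable_theta1 hτ
  have d2 := differentiable_theta2 hτ
  have d1' : Differentiable ℂ (deriv (theta1 · τ)) := fun z => (d1.analyticAt z).deriv.differentiableAt
  have d2' : Differentiable ℂ (deriv (theta2 · τ)) := fun z => (d2.analyticAt z).deriv.differentiableAt
  have hm : ∀ z, HasDerivAt (fun z => exp (-piC * I * τ - 2 * I * z))
      (exp (-piC * I * τ - 2 * I * z) * (-(2 * I))) z := fun z => by
    refine HasDerivAt.cexp ?_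
    simpa using ((hasDerivAt_id z).const_mul (2 * I)).const_sub (-piC * I * τ)
  refine ⟨⟨by fun_prop, fun z => ?_, fun z => ?_⟩, fun z => ?_⟩
  · have h1 : deriv (theta1 · τ) (z + piC) = -deriv (theta1 · τ) z := by
      rw [← deriv_comp_add_const, ← deriv.fun_neg]
      simp only [theta1_add_piC]
    have h2 : deriv (theta2 · τ) (z + piC) = -deriv (theta2 · τ) z := by
      rw [← deriv_comp_add_const, ← deriv.fun_neg]
      simp only [theta2_add_piC hτ]
    simp only [h1, h2, theta1_add_piC, theta2_add_piC hτ]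
    ring
  · have h1 : deriv (theta1 · τ) (z + piC * τ) = exp (-piC * I * τ - 2 * I * z) *
        (2 * I * theta1 z τ - deriv (theta1 · τ) z) := by
      rw [← deriv_comp_add_const]
      simp only [theta1_add_period hτ]
      rw [((hm z).fun_neg.fun_mul (d1 z).hasDerivAt).deriv]
      ring
    have h2 : deriv (theta2 · τ) (z + piC * τ) = exp (-piC * I * τ - 2 * I * z) *
        (-(2 * I) * theta2 z τ + deriv (theta2 · τ) z) := by
      rw [← deriv_comp_add_const]
      simp only [theta2_add_period hτ]
      rw [((hm z).fun_mul (d2 z).hasDerivAt).deriv]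
      ring
    have h : exp (2 * piC * I * τ) * exp (2 * I * (2 : ℤ) * z) *
        exp (-piC * I * τ - 2 * I * z) ^ 2 = 1 := by
      rw [← exp_nat_mul, ← exp_add, ← exp_add, exp_eq_one_iff]
      exact ⟨0, by push_cast; ring⟩
    simp only [h1, h2, theta1_add_period hτ, theta2_add_period hτ]
    linear_combination -(deriv (theta1 · τ) z * theta2 z τ - theta1 z τ * deriv (theta2 · τ) z) * h
  · have h1 : deriv (theta1 · τ) (-z) = deriv (theta1 · τ) z := by
      rw [← neg_neg (deriv _ (-z)), ← deriv_comp_neg]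
      simp only [theta1_neg, deriv.fun_neg, neg_neg]
    have h2 : deriv (theta2 · τ) (-z) = -deriv (theta2 · τ) z := by
      rw [← neg_neg (deriv _ (-z)), ← deriv_comp_neg]
      simp only [theta2_neg]
    simp only [h1, h2, theta1_neg, theta2_neg]
    ring

/-- `θ₁(2z)` and `θ₁θ₂θ₃θ₄` are proportional, with a nonzero constant. -/
theorem exists_theta1_two_mul {τ : ℂ} (hτ : 0 < τ.im) {x : ℂ} (h1 : theta1 (2 * x) τ ≠ 0)
    (h2 : theta1 x τ * theta2 x τ * theta3 x τ * theta4 x τ ≠ 0) :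
    ∃ c : ℂ, c ≠ 0 ∧
      ∀ z, c * theta1 (2 * z) τ = theta1 z τ * theta2 z τ * theta3 z τ * theta4 z τ := by
  have hE := theta1_two_mul_mem hτ
  have hD := theta_prod_mem hτ
  have hE1 : fourierInt (fun z => theta1 (2 * z) τ) 1 ≠ 0 := fun h =>
    h1 (eq_zero_of_odd_degree_four hE h x)
  have hD1 : fourierInt (fun z => theta1 z τ * theta2 z τ * theta3 z τ * theta4 z τ) 1 ≠ 0 :=
    fun h => h2 (eq_zero_of_odd_degree_four hD h x)
  refine ⟨_, div_ne_zero hD1 hE1, fun z => ?_⟩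
  have h := fourierInt_mul_comm 1 (fun h hh hc => eq_zero_of_odd_degree_four hh hc) hE hD z
  rw [div_mul_eq_mul_div, div_eq_iff hE1]
  linear_combination h

/-- If `f(2z) c = f(z) P(z)` with `c ≠ 0` and `f` analytic and not locally zero at `0`, then
`P(0) ≠ 0`. -/
theorem ne_zero_of_comp_two_mul {f P : ℂ → ℂ} (hf : AnalyticAt ℂ f 0)
    (hf0 : ¬∀ᶠ z in nhds 0, f z = 0) (hP : ContinuousAt P 0) {c : ℂ} (hc : c ≠ 0)
    (h : ∀ z, c * f (2 * z) = f z * P z) : P 0 ≠ 0 := by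
  obtain ⟨k, g, hg, hg0, hfg⟩ := hf.exists_eventuallyEq_pow_smul_nonzero_iff.mpr hf0
  have ht : Filter.Tendsto (fun z : ℂ => 2 * z) (nhds 0) (nhds 0) :=
    (continuous_const_mul 2).tendsto' 0 0 (mul_zero 2)
  have hev : ∀ᶠ z in nhdsWithin (0 : ℂ) {0}ᶜ, c * 2 ^ k * g (2 * z) = g z * P z := by
    filter_upwards [hfg.filter_mono nhdsWithin_le_nhds,
      (ht.eventually hfg).filter_mono nhdsWithin_le_nhds, self_mem_nhdsWithin] with z hz hz2 hz0
    have hz' := h z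
    rw [hz, hz2, sub_zero, sub_zero, smul_eq_mul, smul_eq_mul, mul_pow] at hz'
    refine mul_left_cancel₀ (pow_ne_zero k hz0) ?_
    linear_combination hz'
  have hl : Filter.Tendsto (fun z => c * 2 ^ k * g (2 * z)) (nhdsWithin 0 {0}ᶜ)
      (nhds (c * 2 ^ k * g 0)) :=
    ((hg.continuousAt.tendsto.comp ht).const_mul _).mono_left nhdsWithin_le_nhds
  have hr : Filter.Tendsto (fun z => g z * P z) (nhdsWithin 0 {0}ᶜ) (nhds (g 0 * P 0)) :=
    (hg.continuousAt.tendsto.mul hP.tendsto).mono_left nhdsWithin_le_nhds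
  have heq := tendsto_nhds_unique (hl.congr' hev) hr
  intro h0
  rw [h0, mul_zero] at heq
  exact mul_ne_zero (mul_ne_zero hc (pow_ne_zero k two_ne_zero)) hg0 heq

theorem not_eventually_theta1_eq_zero {τ : ℂ} (hτ : 0 < τ.im) {x : ℂ} (hx : theta1 x τ ≠ 0) :
    ¬∀ᶠ z in nhds 0, theta1 z τ = 0 := fun h =>
  hx (congrFun (AnalyticOnNhd.eq_of_eventuallyEq
    (fun z _ => (differentiable_theta1 hτ).analyticAt z) (fun _ _ => analyticAt_const)
    (g := fun _ => 0) h) x)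

theorem deriv_theta1_zero_ne_zero {τ : ℂ} (hτ : 0 < τ.im) {x : ℂ} (hx : theta1 x τ ≠ 0)
    (h2 : theta2 0 τ ≠ 0) (h34 : theta3 0 τ * theta4 0 τ ≠ 0) :
    deriv (theta1 · τ) 0 ≠ 0 := by
  intro h0
  have hW := theta_wronskian_mem hτ
  have hT := theta34_mem hτ
  have hprop := fourierInt_mul_comm 0 (fun h hh hc => eq_zero_of_even_degree_two hh hc) hW hT 0
  simp only [h0, theta1_zero, zero_mul, sub_zero, mul_zero] at hprop
  have hz := eq_zero_of_even_degree_two hW ((mul_eq_zero.mp hprop.symm).resolve_right h34)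
  have d1 := differentiable_theta1 hτ
  have d2 := differentiable_theta2 hτ
  obtain ⟨r, hr, hball⟩ := Metric.eventually_nhds_iff_ball.mp
    (d2.continuous.continuousAt.eventually_ne h2)
  refine not_eventually_theta1_eq_zero hτ hx ?_
  filter_upwards [Metric.ball_mem_nhds 0 hr] with z hzr
  have hc := Metric.isOpen_ball.is_const_of_deriv_eq_zero
    (convex_ball (0 : ℂ) r).isPreconnected (f := fun z => theta1 z τ / theta2 z τ)
    (fun w hw => ((d1 w).fun_div (d2 w) (hball w hw)).differentiableWithinAt)
    (fun w hw => by
      rw [((d1 w).hasDerivAt.fun_div (d2 w).hasDerivAt (hball w hw)).deriv, hz w]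
      simp) hzr (Metric.mem_ball_self hr)
  simp only [theta1_zero, zero_div] at hc
  exact (div_eq_zero_iff.mp hc).resolve_right (hball z hzr)

/-- The duplication formula for `θ₁`. -/
theorem theta1_two_mul {τ : ℂ} (hτ : 0 < τ.im) {x : ℂ} (h1 : theta1 (2 * x) τ ≠ 0)
    (h2 : theta1 x τ * theta2 x τ * theta3 x τ * theta4 x τ ≠ 0) :
    theta2 0 τ * theta3 0 τ * theta4 0 τ ≠ 0 ∧
      theta2 0 τ * theta3 0 τ * theta4 0 τ * theta1 (2 * x) τ =
        2 * (theta1 x τ * theta2 x τ * theta3 x τ * theta4 x τ) := by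
  obtain ⟨c, hc, h⟩ := exists_theta1_two_mul hτ h1 h2
  have d1 := differentiable_theta1 hτ
  have d2 := differentiable_theta2 hτ
  have d3 := differentiable_theta3 hτ
  have d4 := differentiable_theta4 hτ
  have dP : Differentiable ℂ (fun z => theta2 z τ * theta3 z τ * theta4 z τ) := by fun_prop
  have hx : theta1 x τ ≠ 0 := by
    simp only [ne_eq, mul_eq_zero, not_or] at h2
    exact h2.1.1.1
  have hP := ne_zero_of_comp_two_mul (d1.analyticAt 0) (not_eventually_theta1_eq_zero hτ hx)
    dP.continuous.continuousAt hc (fun z => (h z).trans (by ring))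
  refine ⟨hP, ?_⟩
  have hP' := hP
  simp only [ne_eq, mul_eq_zero, not_or] at hP'
  have hd := deriv_theta1_zero_ne_zero hτ hx hP'.1.1 (mul_ne_zero hP'.1.2 hP'.2)
  have hcP : 2 * c = theta2 0 τ * theta3 0 τ * theta4 0 τ := by
    have hl : deriv (fun z => c * theta1 (2 * z) τ) 0 = c * (2 * deriv (theta1 · τ) 0) := by
      rw [deriv_const_mul_field, deriv_comp_mul_left 2 (theta1 · τ) 0, mul_zero, smul_eq_mul]
    have hr : deriv (fun z => theta1 z τ * (theta2 z τ * theta3 z τ * theta4 z τ)) 0 =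
        deriv (theta1 · τ) 0 * (theta2 0 τ * theta3 0 τ * theta4 0 τ) := by
      rw [((d1 0).hasDerivAt.fun_mul (dP 0).hasDerivAt).deriv, theta1_zero, zero_mul, add_zero]
    have hfun : (fun z => c * theta1 (2 * z) τ) =
        fun z => theta1 z τ * (theta2 z τ * theta3 z τ * theta4 z τ) :=
      funext fun z => (h z).trans (by ring)
    rw [hfun, hr] at hl
    refine mul_left_cancel₀ hd ?_
    linear_combination -hl
  rw [← hcP, ← h]
  ring

theorem sq_mul_mul_mem {τ : ℂ} {f g h : ℂ → ℂ} (hf : Differentiable ℂ f)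
    (hg : Differentiable ℂ g) (hh : Differentiable ℂ h)
    (hp : ∀ k ∈ [f, g, h], ∀ z, k (z + piC) ^ 2 = k z ^ 2)
    (hq : ∀ k ∈ [f, g, h], ∀ z,
      k (z + piC * τ) ^ 2 = exp (-piC * I * τ - 2 * I * z) ^ 2 * k z ^ 2)
    (he : ∀ k ∈ [f, g, h], ∀ z, k (-z) ^ 2 = k z ^ 2) :
    (fun z => (f z * g z * h z) ^ 2) ∈
      quasiPeriodicSpace (qq τ ^ 3) τ 6 ⊓ paritySpace 1 := by
  simp only [List.forall_mem_cons, List.forall_mem_nil, and_true] at hp hq he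
  refine ⟨⟨by fun_prop, fun z => ?_, fun z => ?_⟩, fun z => ?_⟩
  · simp only [mul_pow, hp.1, hp.2.1, hp.2.2]
  · have hm : qq τ ^ 3 * exp (2 * I * (6 : ℤ) * z) *
        exp (-piC * I * τ - 2 * I * z) ^ 6 = 1 := by
      rw [qq, ← exp_nat_mul, ← exp_nat_mul, ← exp_add, ← exp_add, exp_eq_one_iff]
      exact ⟨0, by push_cast; ring⟩
    simp only [mul_pow, hq.1, hq.2.1, hq.2.2]
    linear_combination -(f z ^ 2 * g z ^ 2 * h z ^ 2) * hm
  · simp only [mul_pow, he.1, he.2.1, he.2.2, one_mul]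

theorem sq_theta_triple_mem {τ : ℂ} (hτ : 0 < τ.im) (i : Fin 4) :
    (![fun z => (theta2 z τ * theta3 z τ * theta4 z τ) ^ 2,
      fun z => (theta1 z τ * theta3 z τ * theta4 z τ) ^ 2,
      fun z => (theta1 z τ * theta2 z τ * theta4 z τ) ^ 2,
      fun z => (theta1 z τ * theta2 z τ * theta3 z τ) ^ 2] : Fin 4 → ℂ → ℂ) i ∈
      quasiPeriodicSpace (qq τ ^ 3) τ 6 ⊓ paritySpace 1 := by
  have d1 := differentiable_theta1 hτ
  have d2 := differentiable_theta2 hτ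
  have d3 := differentiable_theta3 hτ
  have d4 := differentiable_theta4 hτ
  have hp : ∀ k ∈ [(theta1 · τ), (theta2 · τ), (theta3 · τ), (theta4 · τ)], ∀ z,
      k (z + piC) ^ 2 = k z ^ 2 := by
    simp [theta1_add_piC, theta2_add_piC hτ, theta3_add_piC hτ, theta4_add_piC hτ]
  have hq : ∀ k ∈ [(theta1 · τ), (theta2 · τ), (theta3 · τ), (theta4 · τ)], ∀ z,
      k (z + piC * τ) ^ 2 = exp (-piC * I * τ - 2 * I * z) ^ 2 * k z ^ 2 := by
    simp [theta1_add_period hτ, theta2_add_period hτ, theta3_add_period hτ,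
      theta4_add_period hτ, mul_pow]
  have he : ∀ k ∈ [(theta1 · τ), (theta2 · τ), (theta3 · τ), (theta4 · τ)], ∀ z,
      k (-z) ^ 2 = k z ^ 2 := by
    simp [theta1_neg, theta2_neg, theta3_neg, theta4_neg]
  match i with
  | 0 =>
    have hs : [(theta2 · τ), (theta3 · τ), (theta4 · τ)] ⊆
      [(theta1 · τ), (theta2 · τ), (theta3 · τ), (theta4 · τ)] := by simp
    exact sq_mul_mul_mem d2 d3 d4 (fun k hk => hp k (hs hk)) (fun k hk => hq k (hs hk))
      (fun k hk => he k (hs hk))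
  | 1 =>
    have hs : [(theta1 · τ), (theta3 · τ), (theta4 · τ)] ⊆
      [(theta1 · τ), (theta2 · τ), (theta3 · τ), (theta4 · τ)] := by simp
    exact sq_mul_mul_mem d1 d3 d4 (fun k hk => hp k (hs hk)) (fun k hk => hq k (hs hk))
      (fun k hk => he k (hs hk))
  | 2 =>
    have hs : [(theta1 · τ), (theta2 · τ), (theta4 · τ)] ⊆
      [(theta1 · τ), (theta2 · τ), (theta3 · τ), (theta4 · τ)] := by simp
    exact sq_mul_mul_mem d1 d2 d4 (fun k hk => hp k (hs hk)) (fun k hk => hq k (hs hk))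
      (fun k hk => he k (hs hk))
  | 3 =>
    have hs : [(theta1 · τ), (theta2 · τ), (theta3 · τ)] ⊆
      [(theta1 · τ), (theta2 · τ), (theta3 · τ), (theta4 · τ)] := by simp
    exact sq_mul_mul_mem d1 d2 d3 (fun k hk => hp k (hs hk)) (fun k hk => hq k (hs hk))
      (fun k hk => he k (hs hk))

theorem statement19 (τ : ℂ) (hτ : 0 < τ.im) (F : ℂ → ℂ)
    (hF : Differentiable ℂ F)
    (heven : ∀ z : ℂ, F (-z) = F z)
    (hper1 : ∀ z : ℂ, F z = F (z + piC))
    (hper2 : ∀ z : ℂ, F z = qq τ ^ 3 * exp (12 * I * z) * F (z + piC * τ))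
    (x : ℂ)
    (h1 : theta1 (2 * x) τ ≠ 0) (h2 : theta1 x τ ≠ 0)
    (h3 : theta2 x τ ≠ 0) (h4 : theta3 x τ ≠ 0) (h5 : theta4 x τ ≠ 0) :
    4 * F x / theta1 (2 * x) τ ^ 2 =
      F 0 / theta1 x τ ^ 2 + F (piC / 2) / theta2 x τ ^ 2
        - exp (3 * piC * I * τ / 2) * F ((piC + piC * τ) / 2) / theta3 x τ ^ 2
        - exp (3 * piC * I * τ / 2) * F (piC * τ / 2) / theta4 x τ ^ 2 := by
  have hprod : theta1 x τ * theta2 x τ * theta3 x τ * theta4 x τ ≠ 0 :=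
    mul_ne_zero (mul_ne_zero (mul_ne_zero h2 h3) h4) h5
  obtain ⟨hP, hdup⟩ := theta1_two_mul hτ h1 hprod
  have hA : qq τ ^ 3 ≠ 0 := pow_ne_zero 3 (exp_ne_zero _)
  have hFmem : F ∈ quasiPeriodicSpace (qq τ ^ 3) τ 6 ⊓ paritySpace 1 := by
    refine ⟨⟨hF, fun z => (hper1 z).symm, fun z => ?_⟩, fun z => by rw [heven, one_mul]⟩
    rw [hper2 z, show 12 * I * z = 2 * I * (6 : ℤ) * z by push_cast; ring]
  let G : Fin 4 → ℂ → ℂ := ![fun z => (theta2 z τ * theta3 z τ * theta4 z τ) ^ 2,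
    fun z => (theta1 z τ * theta3 z τ * theta4 z τ) ^ 2,
    fun z => (theta1 z τ * theta2 z τ * theta4 z τ) ^ 2,
    fun z => (theta1 z τ * theta2 z τ * theta3 z τ) ^ 2]
  let p : Fin 4 → ℂ := ![0, piC / 2, (piC + piC * τ) / 2, piC * τ / 2]
  have hG : ∀ i, G i ∈ quasiPeriodicSpace (qq τ ^ 3) τ 6 ⊓ paritySpace 1 :=
    sq_theta_triple_mem hτ
  have hpi : piC / 2 = 0 + piC / 2 := (zero_add _).symm
  have hhalf : piC * τ / 2 = 0 + piC * τ / 2 := (zero_add _).symm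
  have hsum : (piC + piC * τ) / 2 = 0 + piC * τ / 2 + piC / 2 := by ring
  have e11 : theta1 (piC / 2) τ = theta2 0 τ := by rw [hpi, theta1_add_piC_div_two hτ]
  have e12 : theta2 (piC / 2) τ = 0 := by
    rw [hpi, theta2_add_piC_div_two hτ, theta1_zero, neg_zero]
  have e13 : theta3 (piC / 2) τ = theta4 0 τ := by rw [hpi, theta3_add_piC_div_two hτ]
  have e14 : theta4 (piC / 2) τ = theta3 0 τ := by rw [hpi, theta4_add_piC_div_two hτ]
  set μ := exp (-piC * I * τ / 4) with hμ
  have hμ0 : μ ≠ 0 := exp_ne_zero _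
  have hμ' : exp (-piC * I * τ / 4 - I * 0) = μ := by rw [mul_zero, sub_zero]
  have e31 : theta1 (piC * τ / 2) τ = I * μ * theta4 0 τ := by
    rw [hhalf, theta1_add_half hτ, hμ']
  have e32 : theta2 (piC * τ / 2) τ = μ * theta3 0 τ := by
    rw [hhalf, theta2_add_half hτ, hμ']
  have e33 : theta3 (piC * τ / 2) τ = μ * theta2 0 τ := by
    rw [hhalf, theta3_add_half hτ, hμ']
  have e34 : theta4 (piC * τ / 2) τ = 0 := by
    rw [hhalf, theta4_add_half hτ, theta1_zero, mul_zero]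
  have e21 : theta1 ((piC + piC * τ) / 2) τ = μ * theta3 0 τ := by
    rw [hsum, theta1_add_piC_div_two hτ, zero_add, e32]
  have e22 : theta2 ((piC + piC * τ) / 2) τ = -(I * μ * theta4 0 τ) := by
    rw [hsum, theta2_add_piC_div_two hτ, zero_add, e31]
  have e23 : theta3 ((piC + piC * τ) / 2) τ = 0 := by
    rw [hsum, theta3_add_piC_div_two hτ, zero_add, e34]
  have e24 : theta4 ((piC + piC * τ) / 2) τ = μ * theta2 0 τ := by
    rw [hsum, theta4_add_piC_div_two hτ, zero_add, e33]
  set P := theta2 0 τ * theta3 0 τ * theta4 0 τ with hPdef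
  have g0 : G 0 (p 0) = P ^ 2 := rfl
  have g1 : G 1 (p 1) = P ^ 2 := by
    change (theta1 (piC / 2) τ * theta3 (piC / 2) τ * theta4 (piC / 2) τ) ^ 2 = _
    rw [e11, e13, e14, hPdef]
    ring
  have g2 : G 2 (p 2) = -(μ ^ 6 * P ^ 2) := by
    change (theta1 ((piC + piC * τ) / 2) τ * theta2 ((piC + piC * τ) / 2) τ *
      theta4 ((piC + piC * τ) / 2) τ) ^ 2 = _
    rw [e21, e22, e24, hPdef]
    linear_combination (μ ^ 6 * (theta2 0 τ * theta3 0 τ * theta4 0 τ) ^ 2) * I_sq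
  have g3 : G 3 (p 3) = -(μ ^ 6 * P ^ 2) := by
    change (theta1 (piC * τ / 2) τ * theta2 (piC * τ / 2) τ * theta3 (piC * τ / 2) τ) ^ 2 = _
    rw [e31, e32, e33, hPdef]
    linear_combination (μ ^ 6 * (theta2 0 τ * theta3 0 τ * theta4 0 τ) ^ 2) * I_sq
  have hne : ∀ i, G i (p i) ≠ 0 := fun i => by
    fin_cases i
    · exact g0 ▸ pow_ne_zero 2 hP
    · exact g1 ▸ pow_ne_zero 2 hP
    · exact g2 ▸ neg_ne_zero.mpr (mul_ne_zero (pow_ne_zero 6 hμ0) (pow_ne_zero 2 hP))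
    · exact g3 ▸ neg_ne_zero.mpr (mul_ne_zero (pow_ne_zero 6 hμ0) (pow_ne_zero 2 hP))
  have hoff : ∀ i j, i ≠ j → G i (p j) = 0 := fun i j hij => by
    fin_cases i <;> fin_cases j <;> simp [G, p, theta1_zero, e12, e23, e34] at hij ⊢
  have hmain := eq_sum_of_even_degree_six hA hFmem hG hne hoff x
  rw [Fin.sum_univ_four, g0, g1, g2, g3] at hmain
  change F x = F 0 / P ^ 2 * (theta2 x τ * theta3 x τ * theta4 x τ) ^ 2 +
    F (piC / 2) / P ^ 2 * (theta1 x τ * theta3 x τ * theta4 x τ) ^ 2 +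
    F ((piC + piC * τ) / 2) / -(μ ^ 6 * P ^ 2) * (theta1 x τ * theta2 x τ * theta4 x τ) ^ 2 +
    F (piC * τ / 2) / -(μ ^ 6 * P ^ 2) * (theta1 x τ * theta2 x τ * theta3 x τ) ^ 2 at hmain
  have hν : exp (3 * piC * I * τ / 2) = (μ ^ 6)⁻¹ := by
    rw [hμ, ← exp_nat_mul, ← exp_neg]
    congr 1
    push_cast
    ring
  have hθ : theta1 (2 * x) τ = 2 * (theta1 x τ * theta2 x τ * theta3 x τ * theta4 x τ) / P := by
    rw [eq_div_iff hP]
    linear_combination hdup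
  rw [hν, hθ, hmain]
  field_simp
  ring
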